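/- Let d, M ≥ 1, σ_1,…,σ_M > 0, and let μ be a probability measure on ℝ^d with ∫ ‖x‖ dμ(x) < ∞. Let p(y|x) = ∏_{m=1}^M N(y_m; x, σ_m² I_d) and p_Y(y) = ∫ p(y|x) dμ(x), and write s(y|x) for the vector in (ℝ^d)^M whose m-th block is (x − y_m)/σ_m² (so s(y|x) = ∇_y log p(y|x)). Let g : (ℝ^d)^M → (ℝ^d)^M be measurable with ∫ ‖g(y)‖² p_Y(y) dy < ∞, ∫ ‖∇_y log p_Y(y)‖² p_Y(y) dy < ∞, and ∫∫ ‖s(y|x)‖² p(y|x) dμ(x) dy < ∞. Then the score matching objective equals the multimeasurement denoising score matching objective up to an additive constant independent of g: ∫ ‖g(y) − ∇_y log p_Y(y)‖² p_Y(y) dy = ∫∫ ‖g(y) − s(y|x)‖² p(y|x) dμ(x) dy + C, where C = ∫ ‖∇_y log p_Y(y)‖² p_Y(y) dy − ∫∫ ‖s(y|x)‖² p(y|x) dμ(x) dy does not depend on g. -/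

import Mathlib

open MeasureTheory Finset

/-- The Gaussian multimeasurement noise-model kernel
`p(y|x) = ∏_{m=1}^M (2πσ_m²)^{-d/2} exp(−‖y_m − x‖²/(2σ_m²))`. -/
noncomputable def mnmKernel (d M : ℕ) (σ : Fin M → ℝ)
    (y : Fin M → EuclideanSpace ℝ (Fin d)) (x : EuclideanSpace ℝ (Fin d)) : ℝ :=
  ∏ m, (2 * Real.pi * σ m ^ 2) ^ (-(d : ℝ) / 2) *
    Real.exp (-‖y m - x‖ ^ 2 / (2 * σ m ^ 2))

/-- The Gaussian M-density `p_Y(y) = ∫ p(y|x) dμ(x)`. -/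
noncomputable def mDensity (d M : ℕ) (σ : Fin M → ℝ)
    (μ : Measure (EuclideanSpace ℝ (Fin d))) (y : Fin M → EuclideanSpace ℝ (Fin d)) : ℝ :=
  ∫ x, mnmKernel d M σ y x ∂μ

/-- The `m`-th block of `∇_y log p_Y(y)`, namely `(∇_{y_m} p_Y(y))/p_Y(y)`. -/
noncomputable def mScore (d M : ℕ) (σ : Fin M → ℝ)
    (μ : Measure (EuclideanSpace ℝ (Fin d))) (y : Fin M → EuclideanSpace ℝ (Fin d))
    (m : Fin M) : EuclideanSpace ℝ (Fin d) :=
  (mDensity d M σ μ y)⁻¹ •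
    gradient (fun z => mDensity d M σ μ (Function.update y m z)) (y m)

theorem mnmKernel_pos {d M : ℕ} {σ : Fin M → ℝ} (hσ : ∀ m, 0 < σ m)
    (y : Fin M → EuclideanSpace ℝ (Fin d)) (x : EuclideanSpace ℝ (Fin d)) :
    0 < mnmKernel d M σ y x := by
  refine Finset.prod_pos fun m _ => mul_pos (Real.rpow_pos_of_pos ?_ _) (Real.exp_pos _)
  have := hσ m
  positivity

theorem mnmKernel_le {d M : ℕ} (σ : Fin M → ℝ)
    (y : Fin M → EuclideanSpace ℝ (Fin d)) (x : EuclideanSpace ℝ (Fin d)) :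
    mnmKernel d M σ y x ≤ ∏ m, (2 * Real.pi * σ m ^ 2) ^ (-(d : ℝ) / 2) := by
  refine Finset.prod_le_prod (fun m _ => by positivity) fun m _ => ?_
  refine mul_le_of_le_one_right (by positivity) (Real.exp_le_one_iff.2 ?_)
  exact div_nonpos_of_nonpos_of_nonneg (neg_nonpos.2 (by positivity)) (by positivity)

theorem continuous_mnmKernel (d M : ℕ) (σ : Fin M → ℝ) :
    Continuous fun q : (Fin M → EuclideanSpace ℝ (Fin d)) × EuclideanSpace ℝ (Fin d) =>
      mnmKernel d M σ q.1 q.2 := by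
  unfold mnmKernel
  fun_prop

theorem continuous_mnmKernel_right {d M : ℕ} (σ : Fin M → ℝ)
    (y : Fin M → EuclideanSpace ℝ (Fin d)) : Continuous fun x => mnmKernel d M σ y x := by
  unfold mnmKernel
  fun_prop

theorem integrable_mnmKernel {d M : ℕ} {σ : Fin M → ℝ} (hσ : ∀ m, 0 < σ m)
    (μ : Measure (EuclideanSpace ℝ (Fin d))) [IsFiniteMeasure μ]
    (y : Fin M → EuclideanSpace ℝ (Fin d)) :
    Integrable (fun x => mnmKernel d M σ y x) μ := by
  refine Integrable.of_bound (continuous_mnmKernel_right σ y).aestronglyMeasurable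
    (∏ m, (2 * Real.pi * σ m ^ 2) ^ (-(d : ℝ) / 2)) (ae_of_all _ fun x => ?_)
  rw [Real.norm_of_nonneg (mnmKernel_pos hσ y x).le]
  exact mnmKernel_le σ y x

theorem mDensity_pos {d M : ℕ} {σ : Fin M → ℝ} (hσ : ∀ m, 0 < σ m)
    (μ : Measure (EuclideanSpace ℝ (Fin d))) [IsProbabilityMeasure μ]
    (y : Fin M → EuclideanSpace ℝ (Fin d)) : 0 < mDensity d M σ μ y := by
  unfold mDensity
  rw [integral_pos_iff_support_of_nonneg (fun x => (mnmKernel_pos hσ y x).le)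
    (integrable_mnmKernel hσ μ y)]
  have : Function.support (fun x => mnmKernel d M σ y x) = Set.univ :=
    Set.eq_univ_of_forall fun x => (mnmKernel_pos hσ y x).ne'
  simp [this]

theorem hasFDerivAt_mnmKernel_update (d M : ℕ) (σ : Fin M → ℝ)
    (y : Fin M → EuclideanSpace ℝ (Fin d)) (m : Fin M) (x z : EuclideanSpace ℝ (Fin d)) :
    HasFDerivAt (fun z => mnmKernel d M σ (Function.update y m z) x)
      (innerSL ℝ (mnmKernel d M σ (Function.update y m z) x • (σ m ^ 2)⁻¹ • (x - z))) z := by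
  have hsplit : ∀ z, mnmKernel d M σ (Function.update y m z) x =
      ((∏ i ∈ univ.erase m, (2 * Real.pi * σ i ^ 2) ^ (-(d : ℝ) / 2) *
        Real.exp (-‖y i - x‖ ^ 2 / (2 * σ i ^ 2))) * (2 * Real.pi * σ m ^ 2) ^ (-(d : ℝ) / 2)) *
        Real.exp (-‖z - x‖ ^ 2 / (2 * σ m ^ 2)) := by
    intro z
    rw [mnmKernel, ← Finset.prod_erase_mul univ _ (Finset.mem_univ m), Function.update_self,
      mul_assoc (Finset.prod _ _)]
    refine congrArg (fun c : ℝ => c * _) (Finset.prod_congr rfl fun i hi => ?_)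
    rw [Function.update_of_ne (Finset.ne_of_mem_erase hi)]
  simp only [hsplit]
  have h := (((((hasFDerivAt_id z).sub_const x).norm_sq).neg.mul_const
    (2 * σ m ^ 2)⁻¹).exp).const_mul ((∏ i ∈ univ.erase m, (2 * Real.pi * σ i ^ 2) ^ (-(d : ℝ) / 2) *
        Real.exp (-‖y i - x‖ ^ 2 / (2 * σ i ^ 2))) * (2 * Real.pi * σ m ^ 2) ^ (-(d : ℝ) / 2))
  simp only [div_eq_mul_inv] at h ⊢
  refine HasFDerivAt.congr_fderiv h ?_
  ext v
  simp
  ring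

theorem integrable_mnmKernel_smul_score {d M : ℕ} {σ : Fin M → ℝ} (hσ : ∀ m, 0 < σ m)
    (μ : Measure (EuclideanSpace ℝ (Fin d))) [IsFiniteMeasure μ]
    (hmom : Integrable (fun x => ‖x‖) μ) (y : Fin M → EuclideanSpace ℝ (Fin d)) (m : Fin M) :
    Integrable (fun x => mnmKernel d M σ y x • (σ m ^ 2)⁻¹ • (x - y m)) μ := by
  have hid : Integrable (fun x : EuclideanSpace ℝ (Fin d) => x) μ :=
    (integrable_norm_iff continuous_id.aestronglyMeasurable).1 hmom
  refine ((hid.sub (integrable_const (y m))).smul (σ m ^ 2)⁻¹).bdd_smul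
    (∏ m, (2 * Real.pi * σ m ^ 2) ^ (-(d : ℝ) / 2)) (continuous_mnmKernel_right σ y).aestronglyMeasurable
    (ae_of_all _ fun x => ?_)
  rw [Real.norm_of_nonneg (mnmKernel_pos hσ y x).le]
  exact mnmKernel_le σ y x

theorem hasGradientAt_mDensity_update {d M : ℕ} {σ : Fin M → ℝ} (hσ : ∀ m, 0 < σ m)
    (μ : Measure (EuclideanSpace ℝ (Fin d))) [IsFiniteMeasure μ]
    (hmom : Integrable (fun x => ‖x‖) μ) (y : Fin M → EuclideanSpace ℝ (Fin d)) (m : Fin M) :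
    HasGradientAt (fun z => mDensity d M σ μ (Function.update y m z))
      (∫ x, mnmKernel d M σ y x • (σ m ^ 2)⁻¹ • (x - y m) ∂μ) (y m) := by
  have hint := integrable_mnmKernel_smul_score hσ μ hmom y m
  have hmeas : ∀ z, AEStronglyMeasurable
      (fun x => mnmKernel d M σ (Function.update y m z) x) μ :=
    fun z => (integrable_mnmKernel hσ μ _).aestronglyMeasurable
  have key := hasFDerivAt_integral_of_dominated_of_fderiv_le (𝕜 := ℝ) (μ := μ)
    (F := fun z x => mnmKernel d M σ (Function.update y m z) x)
    (F' := fun z x =>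
      innerSL ℝ (mnmKernel d M σ (Function.update y m z) x • (σ m ^ 2)⁻¹ • (x - z)))
    (bound := fun x => (∏ m, (2 * Real.pi * σ m ^ 2) ^ (-(d : ℝ) / 2)) *
      ((σ m ^ 2)⁻¹ * (‖x‖ + (‖y m‖ + 1))))
    (x₀ := y m) (Metric.ball_mem_nhds (y m) one_pos)
    (Filter.Eventually.of_forall hmeas) (integrable_mnmKernel hσ μ _)
    ((innerSL ℝ).continuous.comp_aestronglyMeasurable
      (by simpa using hint.aestronglyMeasurable))
    (ae_of_all _ fun x z hz => ?_)
    (((hmom.add (integrable_const _)).const_mul _).const_mul _)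
    (ae_of_all _ fun x z _ => hasFDerivAt_mnmKernel_update d M σ y m x z)
  · rw [hasGradientAt_iff_hasFDerivAt]
    refine key.congr_fderiv ?_
    simp only [Function.update_eq_self]
    exact (innerSL ℝ).integral_comp_comm hint
  · rw [innerSL_apply_norm, norm_smul, norm_smul,
      Real.norm_of_nonneg (mnmKernel_pos hσ _ x).le, Real.norm_of_nonneg (by positivity)]
    have hz' : ‖z‖ ≤ ‖y m‖ + 1 := by
      have h1 := norm_le_norm_add_norm_sub' z (y m)
      rw [mem_ball_iff_norm] at hz
      linarith
    have hxz : ‖x - z‖ ≤ ‖x‖ + (‖y m‖ + 1) := (norm_sub_le x z).trans (by linarith)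
    gcongr
    exact mnmKernel_le σ _ x

/-- Tweedie-type identity: `p_Y(y)` times the score is the kernel-weighted conditional score. -/
theorem mDensity_smul_mScore {d M : ℕ} {σ : Fin M → ℝ} (hσ : ∀ m, 0 < σ m)
    (μ : Measure (EuclideanSpace ℝ (Fin d))) [IsProbabilityMeasure μ]
    (hmom : Integrable (fun x => ‖x‖) μ) (y : Fin M → EuclideanSpace ℝ (Fin d)) (m : Fin M) :
    mDensity d M σ μ y • mScore d M σ μ y m =
      ∫ x, mnmKernel d M σ y x • (σ m ^ 2)⁻¹ • (x - y m) ∂μ := by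
  rw [mScore, smul_inv_smul₀ (mDensity_pos hσ μ y).ne',
    (hasGradientAt_mDensity_update hσ μ hmom y m).gradient]

theorem measurable_integral_mnmKernel_smul_score (d M : ℕ) (σ : Fin M → ℝ)
    (μ : Measure (EuclideanSpace ℝ (Fin d))) [SFinite μ] (m : Fin M) :
    Measurable fun y : Fin M → EuclideanSpace ℝ (Fin d) =>
      ∫ x, mnmKernel d M σ y x • (σ m ^ 2)⁻¹ • (x - y m) ∂μ := by
  have hc : Continuous
      fun q : (Fin M → EuclideanSpace ℝ (Fin d)) × EuclideanSpace ℝ (Fin d) =>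
        mnmKernel d M σ q.1 q.2 • (σ m ^ 2)⁻¹ • (q.2 - q.1 m) :=
    (continuous_mnmKernel d M σ).smul (by fun_prop)
  exact hc.stronglyMeasurable.integral_prod_right.measurable

theorem sum_norm_sub_sq_mul {ι E : Type*} [Fintype ι] [NormedAddCommGroup E]
    [InnerProductSpace ℝ E] (a b : ι → E) (c : ℝ) :
    (∑ i, ‖a i - b i‖ ^ 2) * c =
      (∑ i, ‖a i‖ ^ 2) * c - 2 * (∑ i, inner ℝ (a i) (c • b i)) + (∑ i, ‖b i‖ ^ 2) * c := by
  simp only [norm_sub_sq_real, inner_smul_right, Finset.sum_add_distrib, Finset.sum_sub_distrib,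
    ← Finset.mul_sum]
  ring

/-- Score matching on the M-density equals multimeasurement denoising score matching up to
an additive constant independent of the candidate score `g`. Norms on `(ℝ^d)^M` are written
blockwise; the `m`-th block of `∇_y log p(y|x)` is `(x − y_m)/σ_m²`. -/
theorem score_matching_eq_mdsm (d M : ℕ) (hd : 1 ≤ d) (hM : 1 ≤ M)
    (σ : Fin M → ℝ) (hσ : ∀ m, 0 < σ m)
    (μ : Measure (EuclideanSpace ℝ (Fin d))) [IsProbabilityMeasure μ]
    (hmom : Integrable (fun x => ‖x‖) μ)
    (g : (Fin M → EuclideanSpace ℝ (Fin d)) → (Fin M → EuclideanSpace ℝ (Fin d)))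
    (hg : Measurable g)
    (hint1 : Integrable (fun y => (∑ m, ‖g y m‖ ^ 2) * mDensity d M σ μ y) volume)
    (hint2 : Integrable
      (fun y => (∑ m, ‖mScore d M σ μ y m‖ ^ 2) * mDensity d M σ μ y) volume)
    (hint3 : Integrable
      (fun q : (Fin M → EuclideanSpace ℝ (Fin d)) × EuclideanSpace ℝ (Fin d) =>
        (∑ m, ‖(σ m ^ 2)⁻¹ • (q.2 - q.1 m)‖ ^ 2) * mnmKernel d M σ q.1 q.2)
      (volume.prod μ)) :
    ∫ y, (∑ m, ‖g y m - mScore d M σ μ y m‖ ^ 2) * mDensity d M σ μ y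
      = (∫ y, ∫ x,
            (∑ m, ‖g y m - (σ m ^ 2)⁻¹ • (x - y m)‖ ^ 2) * mnmKernel d M σ y x ∂μ)
        + ((∫ y, (∑ m, ‖mScore d M σ μ y m‖ ^ 2) * mDensity d M σ μ y)
            - ∫ y, ∫ x,
                (∑ m, ‖(σ m ^ 2)⁻¹ • (x - y m)‖ ^ 2) * mnmKernel d M σ y x ∂μ) := by
  have hp : ∀ y, 0 < mDensity d M σ μ y := mDensity_pos hσ μ
  have hF : ∀ y, (∑ m, ‖g y m - mScore d M σ μ y m‖ ^ 2) * mDensity d M σ μ y =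
      (∑ m, ‖g y m‖ ^ 2) * mDensity d M σ μ y
        - 2 * (∑ m, inner ℝ (g y m) (mDensity d M σ μ y • mScore d M σ μ y m))
        + (∑ m, ‖mScore d M σ μ y m‖ ^ 2) * mDensity d M σ μ y :=
    fun y => sum_norm_sub_sq_mul _ _ _
  have hG : ∀ᵐ y, (∫ x,
      (∑ m, ‖g y m - (σ m ^ 2)⁻¹ • (x - y m)‖ ^ 2) * mnmKernel d M σ y x ∂μ) =
      (∑ m, ‖g y m‖ ^ 2) * mDensity d M σ μ y
        - 2 * (∑ m, inner ℝ (g y m) (mDensity d M σ μ y • mScore d M σ μ y m))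
        + ∫ x, (∑ m, ‖(σ m ^ 2)⁻¹ • (x - y m)‖ ^ 2) * mnmKernel d M σ y x ∂μ := by
    filter_upwards [hint3.prod_right_ae] with y hy
    have hs := fun m => integrable_mnmKernel_smul_score hσ μ hmom y m
    have hK := (integrable_mnmKernel hσ μ y).const_mul (∑ m, ‖g y m‖ ^ 2)
    have hinner : Integrable (fun x => ∑ m, inner ℝ (g y m)
        (mnmKernel d M σ y x • (σ m ^ 2)⁻¹ • (x - y m))) μ :=
      integrable_finsetSum _ fun m _ => (hs m).const_inner (g y m)
    simp only [sum_norm_sub_sq_mul, mDensity_smul_mScore hσ μ hmom]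
    have hsub : Integrable (fun x => (∑ m, ‖g y m‖ ^ 2) * mnmKernel d M σ y x -
        2 * ∑ m, inner ℝ (g y m) (mnmKernel d M σ y x • (σ m ^ 2)⁻¹ • (x - y m))) μ :=
      hK.sub (hinner.const_mul 2)
    rw [integral_add hsub hy, integral_sub hK (hinner.const_mul 2),
      integral_const_mul, integral_const_mul,
      integral_finsetSum _ fun m _ => (hs m).const_inner (g y m)]
    simp only [integral_inner (hs _), mDensity]
  have hC : Integrable (fun y =>
      ∑ m, inner ℝ (g y m) (mDensity d M σ μ y • mScore d M σ μ y m)) volume := by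
    refine (hint1.add hint2).mono' ?_ (ae_of_all _ fun y => ?_)
    · simp only [mDensity_smul_mScore hσ μ hmom]
      refine (Finset.measurable_sum _ fun m _ => Measurable.inner (by fun_prop)
        (measurable_integral_mnmKernel_smul_score d M σ μ m)).aestronglyMeasurable
    · refine (norm_sum_le _ _).trans ?_
      rw [Pi.add_apply, ← add_mul, ← Finset.sum_add_distrib, Finset.sum_mul]
      refine Finset.sum_le_sum fun m _ => ?_
      rw [inner_smul_right, norm_mul, Real.norm_of_nonneg (hp y).le, mul_comm]
      refine mul_le_mul_of_nonneg_right ((norm_inner_le_norm _ _).trans ?_) (hp y).le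
      nlinarith [sq_nonneg (‖g y m‖ - ‖mScore d M σ μ y m‖), sq_nonneg ‖g y m‖,
        sq_nonneg ‖mScore d M σ μ y m‖]
  have hgC : Integrable (fun y => (∑ m, ‖g y m‖ ^ 2) * mDensity d M σ μ y -
      2 * ∑ m, inner ℝ (g y m) (mDensity d M σ μ y • mScore d M σ μ y m)) volume :=
    hint1.sub (hC.const_mul 2)
  rw [integral_congr_ae hG]
  simp only [hF]
  rw [integral_add hgC hint2, integral_add hgC hint3.integral_prod_left]
  ring
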